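/- arXiv:1708.06024 — 2 statements merged into one kernel-verified Lean document; each statement's English description precedes it below -/
import Mathlib

section
/- Let K be a field, n ≥ 2 an integer, and q, t ∈ Kˣ with q^m ≠ 1 and t^m ≠ 1 for all integers m ≥ 1. Let M and N be H_{q,t}(GL_n)-modules, each simple and Y-semisimple. Then either M and N are isomorphic as H_{q,t}(GL_n)-modules, or supp(M) ∩ supp(N) = ∅. -/
noncomputable section

/-- Generators of the double affine Hecke algebra `H_{q,t}(GL_n)`:
`T_i` for `i ∈ ℤ/nℤ`, `π` and its inverse, and `Y_1, …, Y_n` and their inverses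
(the generator `Y` with `Fin` index `a` corresponds to `Y_{a+1}`). -/
inductive DGen (n : ℕ) : Type where
  | T : ZMod n → DGen n
  | P : DGen n
  | Pinv : DGen n
  | Y : Fin n → DGen n
  | Yinv : Fin n → DGen n

abbrev FA (K : Type*) [Field K] (n : ℕ) := FreeAlgebra K (DGen n)

def gT (K : Type*) [Field K] (n : ℕ) (i : ZMod n) : FA K n := FreeAlgebra.ι K (DGen.T i)
def gP (K : Type*) [Field K] (n : ℕ) : FA K n := FreeAlgebra.ι K DGen.P
def gPinv (K : Type*) [Field K] (n : ℕ) : FA K n := FreeAlgebra.ι K DGen.Pinv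
def gY (K : Type*) [Field K] (n : ℕ) (i : Fin n) : FA K n := FreeAlgebra.ι K (DGen.Y i)
def gYinv (K : Type*) [Field K] (n : ℕ) (i : Fin n) : FA K n := FreeAlgebra.ι K (DGen.Yinv i)
def sc (K : Type*) [Field K] (n : ℕ) (c : K) : FA K n := algebraMap K (FA K n) c

/-- The defining relations of the double affine Hecke algebra `H_{q,t}(GL_n)`. -/
inductive DahaRel (K : Type*) [Field K] (n : ℕ) (q t : Kˣ) : FA K n → FA K n → Prop where
  | hecke (i : ZMod n) :
      DahaRel K n q t
        ((gT K n i - sc K n (t : K)) * (gT K n i + sc K n ((t⁻¹ : Kˣ) : K))) 0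
  | braid (i : ZMod n) :
      DahaRel K n q t (gT K n i * gT K n (i + 1) * gT K n i)
        (gT K n (i + 1) * gT K n i * gT K n (i + 1))
  | tcomm (i j : ZMod n) (h1 : j ≠ i + 1) (h2 : i ≠ j + 1) :
      DahaRel K n q t (gT K n i * gT K n j) (gT K n j * gT K n i)
  | pPinv : DahaRel K n q t (gP K n * gPinv K n) 1
  | pinvP : DahaRel K n q t (gPinv K n * gP K n) 1
  | ycomm (i j : Fin n) : DahaRel K n q t (gY K n i * gY K n j) (gY K n j * gY K n i)
  | yYinv (i : Fin n) : DahaRel K n q t (gY K n i * gYinv K n i) 1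
  | yinvY (i : Fin n) : DahaRel K n q t (gYinv K n i * gY K n i) 1
  | ptp (i : ZMod n) :
      DahaRel K n q t (gP K n * gT K n i * gPinv K n) (gT K n (i + 1))
  | tyt (a b : Fin n) (h : (b : ℕ) = (a : ℕ) + 1) :
      DahaRel K n q t
        (gT K n (((a : ℕ) + 1 : ℕ) : ZMod n) * gY K n a * gT K n (((a : ℕ) + 1 : ℕ) : ZMod n))
        (gY K n b)
  | t0yt0 (a b : Fin n) (ha : (a : ℕ) = n - 1) (hb : (b : ℕ) = 0) :
      DahaRel K n q t (gT K n 0 * gY K n a * gT K n 0)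
        (sc K n ((q⁻¹ : Kˣ) : K) * gY K n b)
  | tycomm (i : ZMod n) (a : Fin n)
      (h1 : (((a : ℕ) + 1 : ℕ) : ZMod n) ≠ i) (h2 : (((a : ℕ) + 1 : ℕ) : ZMod n) ≠ i + 1) :
      DahaRel K n q t (gT K n i * gY K n a) (gY K n a * gT K n i)
  | pyp (a b : Fin n) (h : (b : ℕ) = (a : ℕ) + 1) :
      DahaRel K n q t (gP K n * gY K n a * gPinv K n) (gY K n b)
  | pynp (a b : Fin n) (ha : (a : ℕ) = n - 1) (hb : (b : ℕ) = 0) :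
      DahaRel K n q t (gP K n * gY K n a * gPinv K n)
        (sc K n ((q⁻¹ : Kˣ) : K) * gY K n b)

/-- The double affine Hecke algebra `H_{q,t}(GL_n)`. -/
abbrev DAHA (K : Type*) [Field K] (n : ℕ) (q t : Kˣ) := RingQuot (DahaRel K n q t)

def Telt (K : Type*) [Field K] (n : ℕ) (q t : Kˣ) (i : ZMod n) : DAHA K n q t :=
  RingQuot.mkAlgHom K (DahaRel K n q t) (gT K n i)
def Pelt (K : Type*) [Field K] (n : ℕ) (q t : Kˣ) : DAHA K n q t :=
  RingQuot.mkAlgHom K (DahaRel K n q t) (gP K n)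
def Pinvelt (K : Type*) [Field K] (n : ℕ) (q t : Kˣ) : DAHA K n q t :=
  RingQuot.mkAlgHom K (DahaRel K n q t) (gPinv K n)
def Yelt (K : Type*) [Field K] (n : ℕ) (q t : Kˣ) (i : Fin n) : DAHA K n q t :=
  RingQuot.mkAlgHom K (DahaRel K n q t) (gY K n i)
def Yinvelt (K : Type*) [Field K] (n : ℕ) (q t : Kˣ) (i : Fin n) : DAHA K n q t :=
  RingQuot.mkAlgHom K (DahaRel K n q t) (gYinv K n i)

/-- The weight space `M[z] = {v ∈ M : Y_i v = z_i v for i = 1,…,n}` of an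
`H_{q,t}(GL_n)`-module `M`, for a weight `z ∈ (Kˣ)^n` (here the `Fin` index `a`
corresponds to the pair `(Y_{a+1}, z_{a+1})`). -/
def wtSet (K : Type*) [Field K] (n : ℕ) (q t : Kˣ) (M : Type*) [AddCommGroup M]
    [Module (DAHA K n q t) M] (z : Fin n → Kˣ) : Set M :=
  {v | ∀ i : Fin n, Yelt K n q t i • v = algebraMap K (DAHA K n q t) ((z i : K)) • v}


section AffinePermutations

variable {n : ℕ}

/-- A function `f` on `ZMod n` encodes the map `x ↦ x + f x` on `ℤ`, which commutes with
translation by `n`. -/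
def affineAct (f : ZMod n → ℤ) (x : ℤ) : ℤ := x + f x

/-- Precomposition with the simple affine reflection exchanging `i` and `i + 1`, in terms of
displacement functions. -/
def affineSwap (i : ZMod n) (f : ZMod n → ℤ) : ZMod n → ℤ :=
  fun r => if r = i then f (i + 1) + 1 else if r = i + 1 then f i - 1 else f r

/-- The simple affine reflection exchanging `i` and `i + 1` modulo `n`. -/
def affineRefl (i : ZMod n) (x : ℤ) : ℤ :=
  if (x : ZMod n) = i then x + 1 else if (x : ZMod n) = i + 1 then x - 1 else x

theorem affineAct_swap (i : ZMod n) (f : ZMod n → ℤ) (x : ℤ) :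
    affineAct (affineSwap i f) x = affineAct f (affineRefl i x) := by
  unfold affineAct affineSwap affineRefl
  split_ifs with h1 h2
  · push_cast; rw [h1]; ring
  · push_cast; rw [h2, add_sub_cancel_right]; ring
  · rfl

theorem affineAct_add_mul (f : ZMod n → ℤ) (x k : ℤ) :
    affineAct f (x + k * n) = affineAct f x + k * n := by
  simp [affineAct]; ring

theorem affineAct_lt_succ_congr {f : ZMod n → ℤ} {x x' : ℤ} (h : (x : ZMod n) = x') :
    affineAct f x < affineAct f (x + 1) ↔ affineAct f x' < affineAct f (x' + 1) := by
  simp [affineAct, h]; omega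

theorem affineAct_swap_self (f : ZMod n → ℤ) (x : ℤ) :
    affineAct (affineSwap (x : ZMod n) f) x = affineAct f (x + 1) := by
  simp [affineAct_swap, affineRefl]

variable [Fact (1 < n)]

theorem affineAct_swap_succ (f : ZMod n → ℤ) (x : ℤ) :
    affineAct (affineSwap (x : ZMod n) f) (x + 1) = affineAct f x := by
  simp [affineAct_swap, affineRefl]


omit [Fact (1 < n)] in
theorem affineAct_swap_of_ne (i : ZMod n) (f : ZMod n → ℤ) (x : ℤ) (h1 : (x : ZMod n) ≠ i)
    (h2 : (x : ZMod n) ≠ i + 1) : affineAct (affineSwap i f) x = affineAct f x := by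
  simp [affineAct_swap, affineRefl, h1, h2]

theorem affineAct_swap_triple {x : ℤ} (hn : (x : ZMod n) + 1 + 1 ≠ x) :
    (∀ f : ZMod n → ℤ, affineAct (affineSwap x f) x = affineAct f (x + 1)) ∧
    (∀ f : ZMod n → ℤ, affineAct (affineSwap x f) (x + 1) = affineAct f x) ∧
    (∀ f : ZMod n → ℤ, affineAct (affineSwap x f) (x + 1 + 1) = affineAct f (x + 1 + 1)) ∧
    (∀ f : ZMod n → ℤ, affineAct (affineSwap ((x : ZMod n) + 1) f) x = affineAct f x) ∧
    (∀ f : ZMod n → ℤ, affineAct (affineSwap ((x : ZMod n) + 1) f) (x + 1) = affineAct f (x + 1 + 1)) ∧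
    (∀ f : ZMod n → ℤ, affineAct (affineSwap ((x : ZMod n) + 1) f) (x + 1 + 1) = affineAct f (x + 1)) := by
  simp [affineAct_swap, affineRefl, hn, Ne.symm hn]

theorem affineSwap_affineSwap (i : ZMod n) (f : ZMod n → ℤ) :
    affineSwap i (affineSwap i f) = f := by
  have h : i + 1 ≠ i := by simp
  funext r
  unfold affineSwap
  grind

omit [Fact (1 < n)] in
theorem affineSwap_comm (i j : ZMod n) (h1 : j ≠ i + 1) (h2 : i ≠ j + 1) (f : ZMod n → ℤ) :
    affineSwap i (affineSwap j f) = affineSwap j (affineSwap i f) := by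
  funext r
  unfold affineSwap
  grind

theorem affineSwap_braid (i : ZMod n) (h : i + 1 + 1 ≠ i) (f : ZMod n → ℤ) :
    affineSwap i (affineSwap (i + 1) (affineSwap i f)) =
      affineSwap (i + 1) (affineSwap i (affineSwap (i + 1) f)) := by
  have h1 : ∀ j : ZMod n, j + 1 ≠ j := by simp
  have h2 := h1 i
  have h3 := h1 (i + 1)
  funext r
  unfold affineSwap
  by_cases hr : r = i
  · subst hr; simp [*, Ne.symm h]
  by_cases hr' : r = i + 1
  · subst hr'; simp [*, Ne.symm h]
  by_cases hr'' : r = i + 1 + 1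
  · subst hr''; simp [*, Ne.symm h]
  · simp [*]

theorem affineRefl_affineRefl (i : ZMod n) (x : ℤ) : affineRefl i (affineRefl i x) = x := by
  have h : i + 1 ≠ i := by simp
  unfold affineRefl
  split_ifs <;> push_cast at * <;> grind

theorem affineRefl_lt_or (i : ZMod n) {x y : ℤ} (hxy : x < y) :
    affineRefl i x < affineRefl i y ∨ ((x : ZMod n) = i ∧ y = x + 1) := by
  have hinj : affineRefl i x ≠ affineRefl i y := fun h =>
    hxy.ne (by rw [← affineRefl_affineRefl i x, h, affineRefl_affineRefl])
  by_cases hy : y = x + 1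
  · by_cases hx : (x : ZMod n) = i
    · exact Or.inr ⟨hx, hy⟩
    · left
      subst hy
      have : (((x + 1 : ℤ)) : ZMod n) ≠ i + 1 := by
        push_cast; simpa using hx
      unfold affineRefl
      split_ifs <;> omega
  · left
    unfold affineRefl at *
    split_ifs at * <;> omega

end AffinePermutations

/-- Elements of a `K`-algebra satisfying the relations of a double affine Hecke algebra of type
`GL_n`, with the commuting family `Y` indexed by all integers. -/
structure DoubleAffineData (K A : Type*) [Field K] [Ring A] [Algebra K A] (n : ℕ) (τ : K) where
  T : ZMod n → A
  Y : ℤ → A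
  P : Aˣ
  T_mul_self : ∀ i, T i * T i = τ • T i + 1
  braid : ∀ i, T i * T (i + 1) * T i = T (i + 1) * T i * T (i + 1)
  T_comm : ∀ i j, j ≠ i + 1 → i ≠ j + 1 → T i * T j = T j * T i
  Y_comm : ∀ x y, Y x * Y y = Y y * Y x
  TYT : ∀ x : ℤ, T x * Y x * T x = Y (x + 1)
  TY_comm : ∀ (i : ZMod n) (x : ℤ), (x : ZMod n) ≠ i → (x : ZMod n) ≠ i + 1 →
    T i * Y x = Y x * T i
  P_T : ∀ i, P * T i = T (i + 1) * P
  P_Y : ∀ x, P * Y x = Y (x + 1) * P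

namespace DoubleAffineData

variable {K A : Type*} [Field K] [Ring A] [Algebra K A] {n : ℕ} {τ : K}
  (D : DoubleAffineData K A n τ)
  {V : Type*} [AddCommGroup V] [Module K V] [Module A V] [IsScalarTower K A V]

theorem Y_succ_mul_T (x : ℤ) : D.Y (x + 1) * D.T x = D.T x * D.Y x + τ • D.Y (x + 1) := by
  rw [← D.TYT x, mul_assoc _ (D.T x) (D.T x), D.T_mul_self]
  simp [mul_add, add_comm]

theorem Y_mul_T (x : ℤ) : D.Y x * D.T x = D.T x * D.Y (x + 1) - τ • D.Y (x + 1) := by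
  rw [← D.TYT x, ← mul_assoc, ← mul_assoc, D.T_mul_self]
  simp [add_mul]

theorem T_smul_T_smul (i : ZMod n) (y : V) : D.T i • D.T i • y = τ • D.T i • y + y := by
  rw [smul_smul, D.T_mul_self, add_smul, one_smul, smul_assoc]

/-- The normalised intertwiners satisfy the braid relation. -/
theorem intertwiner_braid (i : ZMod n) {c₁ c₂ c₃ : K} (hc : c₃ * (τ + c₁ + c₂) = c₁ * c₂)
    (y y₁ y₂ z₁ z₂ : V)
    (hy₁ : y₁ = D.T i • y + c₁ • y) (hy₂ : y₂ = D.T (i + 1) • y₁ + c₃ • y₁)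
    (hz₁ : z₁ = D.T (i + 1) • y + c₂ • y) (hz₂ : z₂ = D.T i • z₁ + c₃ • z₁) :
    D.T i • y₂ + c₂ • y₂ = D.T (i + 1) • z₂ + c₁ • z₂ := by
  have hb : D.T i • D.T (i + 1) • D.T i • y = D.T (i + 1) • D.T i • D.T (i + 1) • y := by
    simp only [smul_smul, ← mul_assoc, D.braid]
  subst hy₁ hy₂ hz₁ hz₂
  have hcomm : ∀ (a : A) (c : K) (w : V), a • c • w = c • a • w := fun a c w => smul_comm a c w
  simp only [smul_add, hcomm, hb, T_smul_T_smul]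
  generalize D.T (i + 1) • D.T i • D.T (i + 1) • y = w₁
  generalize D.T i • D.T (i + 1) • y = w₂
  generalize D.T (i + 1) • D.T i • y = w₃
  generalize D.T i • y = w₄
  generalize D.T (i + 1) • y = w₅
  linear_combination (norm := module) hc • w₄ - hc • w₅

/-- The scalar `c` for which `T_x + c` intertwines the weights `ζ ∘ affineAct f` and
`ζ ∘ affineAct f ∘ affineRefl x`. -/
def IntertwinerCoeff (τ : K) (ζ : ℤ → K) (f : ZMod n → ℤ) (x : ℤ) (c : K) : Prop :=
  (ζ (affineAct f x) - ζ (affineAct f (x + 1))) * c = τ * ζ (affineAct f (x + 1))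

theorem IntertwinerCoeff.congr {ζ : ℤ → K} {u : Kˣ}
    (hζ : ∀ x k : ℤ, ζ (x + k * n) = ((u ^ k : Kˣ) : K) * ζ x)
    {f : ZMod n → ℤ} {x x' : ℤ} (h : (x : ZMod n) = x') {c : K}
    (hc : IntertwinerCoeff τ ζ f x c) : IntertwinerCoeff τ ζ f x' c := by
  obtain ⟨k, hk⟩ := (ZMod.intCast_eq_intCast_iff_dvd_sub x x' n).1 h
  obtain rfl : x' = x + k * n := by linarith [mul_comm (n : ℤ) k]
  unfold IntertwinerCoeff at *
  rw [show x + k * n + 1 = x + 1 + k * n by ring, affineAct_add_mul, affineAct_add_mul, hζ, hζ]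
  linear_combination ((u ^ k : Kˣ) : K) * hc

theorem intertwinerCoeff_triple {τ a b c c₁ c₂ c₃ : K} (hτ : τ ≠ 0) (hb : b ≠ 0) (hc : c ≠ 0)
    (h₁ : (a - b) * c₁ = τ * b) (h₂ : (b - c) * c₂ = τ * c) (h₃ : (a - c) * c₃ = τ * c) :
    c₃ * (τ + c₁ + c₂) = c₁ * c₂ := by
  have hab : a - b ≠ 0 := fun h => by simp_all
  have hbc : b - c ≠ 0 := fun h => by simp_all
  have hac : a - c ≠ 0 := fun h => by simp_all
  obtain rfl : c₁ = τ * b / (a - b) := by rw [eq_div_iff hab, ← h₁]; ring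
  obtain rfl : c₂ = τ * c / (b - c) := by rw [eq_div_iff hbc, ← h₂]; ring
  obtain rfl : c₃ = τ * c / (a - c) := by rw [eq_div_iff hac, ← h₃]; ring
  field_simp
  ring

/-- Vectors obtained from `v` by a power of `P` followed by `k` length-increasing intertwiners,
together with the affine permutation that results. -/
inductive Reached (ζ : ℤ → K) (v : V) : ℕ → (ZMod n → ℤ) → V → Prop
  | base (m : ℤ) : Reached ζ v 0 (fun _ => -m) (D.P ^ m • v)
  | step (k : ℕ) (f : ZMod n → ℤ) (y : V) (x : ℤ) (c : K) (h : Reached ζ v k f y)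
      (hlt : affineAct f x < affineAct f (x + 1)) (hc : IntertwinerCoeff τ ζ f x c) :
      Reached ζ v (k + 1) (affineSwap x f) (D.T x • y + c • y)

section Exchange

variable {D} {ζ : ℤ → K} {v : V} {u : Kˣ} [Fact (1 < n)]

/-- The two reduced paths around a braid hexagon end in the same vector. -/
theorem Reached.hexagon (hτ : τ ≠ 0) (hζ0 : ∀ x, ζ x ≠ 0) {k : ℕ} {f : ZMod n → ℤ} {y : V}
    (h : D.Reached ζ v k f y) {x : ℤ} (hn : (x : ZMod n) + 1 + 1 ≠ x) {a b e : ℤ}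
    (ha : affineAct f x = a) (hb : affineAct f (x + 1) = b) (he : affineAct f (x + 1 + 1) = e)
    (hab : a < b) (hbe : b < e) {c₁ c₂ c₃ : K} (h₁ : (ζ a - ζ b) * c₁ = τ * ζ b)
    (h₂ : (ζ b - ζ e) * c₂ = τ * ζ e) (h₃ : (ζ a - ζ e) * c₃ = τ * ζ e) :
    ∃ y₂ z₂,
      (D.Reached ζ v (k + 2) (affineSwap ((x : ZMod n) + 1) (affineSwap x f)) y₂ ∧
        IntertwinerCoeff τ ζ (affineSwap ((x : ZMod n) + 1) (affineSwap x f)) x c₂) ∧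
      (D.Reached ζ v (k + 2) (affineSwap x (affineSwap ((x : ZMod n) + 1) f)) z₂ ∧
        IntertwinerCoeff τ ζ (affineSwap x (affineSwap ((x : ZMod n) + 1) f)) (x + 1) c₁) ∧
      y₂ = D.T (x + 1) • (D.T x • y + c₁ • y) + c₃ • (D.T x • y + c₁ • y) ∧
      z₂ = D.T x • (D.T (x + 1) • y + c₂ • y) + c₃ • (D.T (x + 1) • y + c₂ • y) ∧
      D.T x • y₂ + c₂ • y₂ = D.T (x + 1) • z₂ + c₁ • z₂ := by
  have hcast : ((x + 1 : ℤ) : ZMod n) = (x : ZMod n) + 1 := by push_cast; rfl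
  obtain ⟨e₁, e₂, e₃, e₄, e₅, e₆⟩ := affineAct_swap_triple hn
  refine ⟨_, _, ⟨?_, ?_⟩, ⟨?_, ?_⟩, rfl, rfl, ?_⟩
  · rw [← hcast]
    refine .step _ _ _ _ _ (.step _ _ _ _ _ h ?_ ?_) ?_ ?_ <;>
      simp only [IntertwinerCoeff, e₂, e₃, ha, hb, he] <;> first | assumption | omega
  · simp only [IntertwinerCoeff, e₁, e₃, e₄, e₅, hb, he]
    assumption
  · rw [← hcast]
    refine .step _ _ _ _ _ (.step _ _ _ _ _ h ?_ ?_) ?_ ?_ <;>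
      simp only [IntertwinerCoeff, hcast, e₄, e₅, ha, hb, he] <;> first | assumption | omega
  · simp only [IntertwinerCoeff, e₂, e₃, e₄, e₆, ha, hb]
    assumption
  · exact D.intertwiner_braid _ (intertwinerCoeff_triple hτ (hζ0 _) (hζ0 _) h₁ h₂ h₃)
      _ _ _ _ _ rfl rfl rfl rfl

/-- The exchange condition: a reached vector at an affine permutation with a descent at `x` arises
from an intertwiner at `x`. -/
theorem Reached.exchange (hτ : τ ≠ 0) (hζ0 : ∀ x, ζ x ≠ 0)
    (hζ : ∀ x k : ℤ, ζ (x + k * n) = ((u ^ k : Kˣ) : K) * ζ x)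
    {k : ℕ} {f : ZMod n → ℤ} {y : V} (h : D.Reached ζ v k f y) (x : ℤ)
    (hx : affineAct f (x + 1) < affineAct f x) :
    ∃ k' y' c, k = k' + 1 ∧ D.Reached ζ v k' (affineSwap x f) y' ∧
      IntertwinerCoeff τ ζ (affineSwap x f) x c ∧ y = D.T x • y' + c • y' := by
  induction k using Nat.strong_induction_on generalizing f y x with
  | _ k ih =>
  cases h with
  | base m => simp [affineAct] at hx
  | step k f y x' c h hlt hc =>
    by_cases hxx : (x' : ZMod n) = x
    · refine ⟨k, y, c, rfl, ?_, ?_, ?_⟩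
      · rwa [hxx, affineSwap_affineSwap]
      · rw [hxx, affineSwap_affineSwap]
        exact hc.congr hζ hxx
      · rw [hxx]
    have hne : ∀ j : ZMod n, j ≠ j + 1 := by simp
    have hcast : ∀ a : ℤ, ((a + 1 : ℤ) : ZMod n) = (a : ZMod n) + 1 := fun a => by push_cast; rfl
    by_cases hadj : (x' : ZMod n) = x + 1
    · rw [← hcast] at hadj
      replace hc : IntertwinerCoeff τ ζ f (x + 1) c := hc.congr hζ hadj
      rw [affineAct_lt_succ_congr hadj] at hlt
      rw [hadj, hcast] at hx ⊢
      clear hxx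
      have hn : (x : ZMod n) + 1 + 1 ≠ x := by
        intro hn
        have hn' : (x : ZMod n) - 1 = x + 1 := by rw [sub_eq_iff_eq_add, hn]
        rw [← hcast, affineAct_swap_self] at hx
        simp only [affineAct_swap] at hx
        simp [affineRefl, affineAct, hn, hn'] at hx hlt
        omega
      obtain ⟨e₁, e₂, e₃, e₄, e₅, e₆⟩ := affineAct_swap_triple hn
      rw [e₄, e₅] at hx
      obtain ⟨k₁, y₁, c₁, rfl, h₁, hc₁, rfl⟩ := ih k (by omega) h x (hlt.trans hx)
      obtain ⟨k₂, y₂, c₂, rfl, h₂, hc₂, rfl⟩ := ih k₁ (by omega) h₁ (x + 1) (by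
        rwa [e₂, e₃])
      rw [hcast] at h₂ hc₂ ⊢
      simp only [IntertwinerCoeff, e₁, e₂, e₃, e₅, e₆] at hc hc₁ hc₂
      obtain ⟨w, z, ⟨hw, hwc⟩, -, hw', hz', hwz⟩ := h₂.hexagon hτ hζ0 hn (by rw [e₄, e₁])
        (by rw [e₅, e₃]) (by rw [e₆, e₂]) hlt hx hc hc₂ hc₁
      rw [← affineSwap_braid _ hn, affineSwap_affineSwap] at hw hwc
      subst hz'
      exact ⟨k₂ + 2, w, c₂, rfl, hw, hwc, hwz.symm⟩
    by_cases hadj' : (x : ZMod n) = x' + 1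
    · obtain ⟨x, rfl⟩ : ∃ p, x = p + 1 := ⟨x - 1, by ring⟩
      rw [hcast] at hadj'
      replace hadj' := (add_right_cancel hadj').symm
      replace hc : IntertwinerCoeff τ ζ f x c := hc.congr hζ hadj'
      rw [affineAct_lt_succ_congr hadj'] at hlt
      rw [hadj'] at hx ⊢
      clear hxx hadj
      have hn : (x : ZMod n) + 1 + 1 ≠ x := by
        intro hn
        rw [affineAct_swap_succ] at hx
        simp only [affineAct_swap] at hx
        simp [affineRefl, affineAct, hn] at hx hlt
        omega
      obtain ⟨e₁, e₂, e₃, e₄, e₅, e₆⟩ := affineAct_swap_triple hn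
      rw [e₂, e₃] at hx
      obtain ⟨k₁, y₁, c₁, rfl, h₁, hc₁, rfl⟩ := ih k (by omega) h (x + 1) (hx.trans hlt)
      rw [hcast] at h₁ hc₁ ⊢
      obtain ⟨k₂, y₂, c₂, rfl, h₂, hc₂, rfl⟩ := ih k₁ (by omega) h₁ x (by rwa [e₄, e₅])
      simp only [IntertwinerCoeff, e₁, e₂, e₄, e₅, e₆] at hc hc₁ hc₂
      obtain ⟨w, z, -, ⟨hw, hwc⟩, hw', hz', hwz⟩ := h₂.hexagon hτ hζ0 hn (by rw [e₁, e₅])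
        (by rw [e₂, e₄]) (by rw [e₃, e₆]) hx hlt hc₂ hc hc₁
      rw [affineSwap_braid _ hn, affineSwap_affineSwap] at hw hwc
      subst hw'
      exact ⟨k₂ + 2, z, c₂, rfl, hw, hwc, hwz⟩
    · have hx' : affineAct f (x + 1) < affineAct f x := by
        rwa [affineAct_swap_of_ne _ _ _ (Ne.symm hxx) hadj', affineAct_swap_of_ne] at hx
        · rw [hcast]; exact Ne.symm hadj
        · rw [hcast]; simpa using Ne.symm hxx
      obtain ⟨k₁, y₁, c₁, rfl, h₁, hc₁, rfl⟩ := ih k (by omega) h x hx'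
      have e₁ := affineAct_swap_of_ne (x : ZMod n) f x' hxx hadj
      have e₂ := affineAct_swap_of_ne (x : ZMod n) f (x' + 1) 
        (by rw [hcast]; exact Ne.symm hadj') (by rw [hcast]; simpa using hxx)
      have e₃ : affineAct (affineSwap x (affineSwap x' f)) x = affineAct (affineSwap x f) x := by
        rw [affineSwap_comm _ _ hadj hadj', affineAct_swap_of_ne _ _ _ (Ne.symm hxx) hadj']
      have e₄ : affineAct (affineSwap x (affineSwap x' f)) (x + 1) =
          affineAct (affineSwap x f) (x + 1) := by
        rw [affineSwap_comm _ _ hadj hadj', affineAct_swap_of_ne]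
        · rw [hcast]; exact Ne.symm hadj
        · rw [hcast]; simpa using Ne.symm hxx
      refine ⟨k₁ + 1, D.T x' • y₁ + c • y₁, c₁, rfl, ?_, ?_, ?_⟩
      · rw [affineSwap_comm _ _ hadj hadj']
        refine .step _ _ _ _ _ h₁ ?_ ?_
        · rwa [e₁, e₂]
        · unfold IntertwinerCoeff
          rwa [e₁, e₂]
      · unfold IntertwinerCoeff
        rwa [e₃, e₄]
      · have hT : D.T x' • D.T x • y₁ = D.T x • D.T x' • y₁ := by
          rw [smul_smul, D.T_comm _ _ hadj' hadj, smul_smul]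
        simp only [smul_add, smul_comm (D.T _) (_ : K), hT]
        generalize D.T x • D.T x' • y₁ = w₁
        generalize D.T x • y₁ = w₂
        generalize D.T x' • y₁ = w₃
        module

omit [Fact (1 < n)] in
theorem Y_mul_P_zpow (D : DoubleAffineData K A n τ) (m x : ℤ) :
    D.Y x * ((D.P ^ m : Aˣ) : A) = ((D.P ^ m : Aˣ) : A) * D.Y (x - m) := by
  induction m generalizing x with
  | zero => simp
  | succ i ih =>
    rw [zpow_add_one, Units.val_mul, ← mul_assoc, ih, mul_assoc, mul_assoc, D.P_Y]
    congr 3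
    ring
  | pred i ih =>
    rw [zpow_sub_one, Units.val_mul, ← mul_assoc, ih, mul_assoc, mul_assoc]
    congr 1
    rw [Units.eq_inv_mul_iff_mul_eq, ← mul_assoc, D.P_Y, mul_assoc, Units.mul_inv, mul_one]
    congr 1
    ring

theorem Reached.weight (hζ : ∀ x k : ℤ, ζ (x + k * n) = ((u ^ k : Kˣ) : K) * ζ x)
    (hv : ∀ x, D.Y x • v = ζ x • v)
    {k : ℕ} {f : ZMod n → ℤ} {y : V} (h : D.Reached ζ v k f y) (x : ℤ) :
    D.Y x • y = ζ (affineAct f x) • y := by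
  induction h generalizing x with
  | base m =>
    rw [Units.smul_def, smul_smul, Y_mul_P_zpow, ← smul_smul, hv, smul_comm]
    rfl
  | step k f y p c h hlt hc ih =>
    have hcast : ∀ a : ℤ, ((a + 1 : ℤ) : ZMod n) = (a : ZMod n) + 1 := fun a => by push_cast; rfl
    by_cases hp : (x : ZMod n) = p
    · replace hc := hc.congr hζ hp.symm
      rw [← hp, affineAct_swap_self, smul_add, smul_smul, Y_mul_T, sub_smul, ← smul_smul, ih,
        smul_assoc, ih, smul_comm (D.T _), smul_comm (D.Y _), ih]
      unfold IntertwinerCoeff at hc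
      generalize D.T (x : ZMod n) • y = w
      linear_combination (norm := module) hc • y
    by_cases hp' : (x : ZMod n) = p + 1
    · obtain ⟨x, rfl⟩ : ∃ a, x = a + 1 := ⟨x - 1, by ring⟩
      rw [hcast] at hp'
      replace hp' := add_right_cancel hp'
      replace hc := hc.congr hζ hp'.symm
      rw [← hp', affineAct_swap_succ, smul_add, smul_smul, Y_succ_mul_T, add_smul, ← smul_smul, ih,
        smul_assoc, ih, smul_comm (D.T _), smul_comm (D.Y _), ih]
      unfold IntertwinerCoeff at hc
      generalize D.T (x : ZMod n) • y = w
      linear_combination (norm := module) -hc • y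
    · rw [affineAct_swap_of_ne _ _ _ hp hp', smul_add, smul_smul, ← D.TY_comm _ _ hp hp',
        ← smul_smul, ih, smul_comm (D.T _), smul_comm (D.Y _), ih, smul_add, smul_comm c]

omit [IsScalarTower K A V] in
theorem Reached.strictMonoOn_level (hτ : τ ≠ 0) (hζ0 : ∀ x, ζ x ≠ 0)
    (hζ : ∀ x k : ℤ, ζ (x + k * n) = ((u ^ k : Kˣ) : K) * ζ x)
    {k : ℕ} {f : ZMod n → ℤ} {y : V} (h : D.Reached ζ v k f y) {a b : ℤ} (hab : a < b)
    (he : ζ (affineAct f a) = ζ (affineAct f b)) : affineAct f a < affineAct f b := by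
  induction h generalizing a b with
  | base m => simpa [affineAct] using hab
  | step k f y p c h hlt hc ih =>
    rcases affineRefl_lt_or (p : ZMod n) hab with h' | ⟨hp, rfl⟩
    · rw [affineAct_swap, affineAct_swap] at he ⊢
      exact ih h' he
    · exfalso
      rw [← hp, affineAct_swap_self, affineAct_swap_succ] at he
      have := hc.congr hζ hp.symm
      unfold IntertwinerCoeff at this
      rw [he, sub_self, zero_mul] at this
      exact mul_ne_zero hτ (hζ0 _) this.symm

omit [IsScalarTower K A V] in
/-- The only reached vector with the weight of the starting vector is that vector itself. -/
theorem Reached.eq_of_weight (hτ : τ ≠ 0) (hζ0 : ∀ x, ζ x ≠ 0)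
    (hζ : ∀ x k : ℤ, ζ (x + k * n) = ((u ^ k : Kˣ) : K) * ζ x)
    (hu : ∀ k : ℤ, u ^ k = 1 → k = 0)
    {k : ℕ} {f : ZMod n → ℤ} {y : V} (h : D.Reached ζ v k f y)
    (hf : ∀ x, ζ (affineAct f x) = ζ x) : y = v := by
  have hsep : ∀ a b : ℤ, (a : ZMod n) = b → ζ a = ζ b → a = b := by
    intro a b hab he
    obtain ⟨k, hk⟩ := (ZMod.intCast_eq_intCast_iff_dvd_sub a b n).1 hab
    obtain rfl : b = a + k * n := by linarith [mul_comm (n : ℤ) k]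
    rw [hζ, right_eq_mul₀ (hζ0 a), Units.val_eq_one] at he
    simp [hu k he]
  have hiter : ∀ x (j : ℕ), ζ ((affineAct f)^[j] x) = ζ x := by
    intro x j
    induction j with
    | zero => rfl
    | succ j ih => rw [Function.iterate_succ_apply', hf, ih]
  have hNZ : NeZero n := ⟨by have := Fact.out (p := 1 < n); omega⟩
  have hrep : ∀ x, ∃ i j : ℕ, i < j ∧ (affineAct f)^[i] x = (affineAct f)^[j] x := by
    intro x
    obtain ⟨i, j, hij, he⟩ := Finite.exists_ne_map_eq_of_infinite
      (fun j : ℕ => (((affineAct f)^[j] x : ℤ) : ZMod n))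
    have := hsep _ _ he (by rw [hiter, hiter])
    rcases hij.lt_or_gt with h | h
    exacts [⟨i, j, h, this⟩, ⟨j, i, h, this.symm⟩]
  have hid : ∀ x, affineAct f x = x := by
    intro x
    obtain ⟨i, j, hij, he⟩ := hrep x
    by_contra hne
    rcases lt_or_gt_of_ne hne with hlt | hlt
    · have : StrictAnti (fun j => (affineAct f)^[j] x) := strictAnti_nat_of_succ_lt fun j => by
        induction j with
        | zero => exact hlt
        | succ j ih =>
          rw [Function.iterate_succ_apply' _ (j + 1), Function.iterate_succ_apply' _ j] at *
          exact h.strictMonoOn_level hτ hζ0 hζ ih (by simp only [hf])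
      exact (this hij).ne' he
    · have : StrictMono (fun j => (affineAct f)^[j] x) := strictMono_nat_of_lt_succ fun j => by
        induction j with
        | zero => exact hlt
        | succ j ih =>
          rw [Function.iterate_succ_apply' _ (j + 1), Function.iterate_succ_apply' _ j] at *
          exact h.strictMonoOn_level hτ hζ0 hζ ih (by simp only [hf])
      exact (this hij).ne he
  cases h with
  | base m =>
    have : m = 0 := by simpa [affineAct] using hid 0
    simp [this]
  | step k f y p c h hlt hc =>
    have h₁ := hid p
    have h₂ := hid (p + 1)
    rw [affineAct_swap_self] at h₁
    rw [affineAct_swap_succ] at h₂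
    omega

end Exchange

section Span

variable {D} {ζ : ℤ → K} {v : V} {u : Kˣ} [Fact (1 < n)]

omit [Fact (1 < n)] in
theorem Reached.smul_of_shift {p : A} {e : ℤ}
    (hpT : ∀ i : ZMod n, p * D.T i = D.T (i + e) * p)
    (hpP : ∀ m : ℤ, p * ((D.P ^ m : Aˣ) : A) = ((D.P ^ (m + e) : Aˣ) : A))
    {k : ℕ} {f : ZMod n → ℤ} {y : V} (h : D.Reached ζ v k f y) :
    D.Reached ζ v k (fun r : ZMod n => f (r - e) - e) (p • y) := by
  have hact : ∀ (f : ZMod n → ℤ) (x : ℤ),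
      affineAct (fun r : ZMod n => f (r - e) - e) (x + e) = affineAct f x := by
    intro f x
    simp [affineAct]
  induction h with
  | base m =>
    have : (fun _ : ZMod n => -m - e) = fun _ => -(m + e) := by funext; ring
    rw [this, Units.smul_def, smul_smul, hpP]
    exact .base (m + e)
  | step k f y x c h hlt hc ih =>
    have hs : (fun r : ZMod n => affineSwap (x : ZMod n) f (r - e) - e) =
        affineSwap ((x + e : ℤ) : ZMod n) (fun r => f (r - e) - e) := by
      funext r
      have h₁ : r - e = (x : ZMod n) ↔ r = x + e := sub_eq_iff_eq_add
      have h₂ : r - e = (x : ZMod n) + 1 ↔ r = x + e + 1 := by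
        rw [sub_eq_iff_eq_add, add_right_comm]
      have h₃ : (x : ZMod n) + e + 1 - e = x + 1 := by ring
      simp only [affineSwap, Int.cast_add, h₁, h₂, h₃, add_sub_cancel_right]
      split_ifs <;> ring
    have hx : x + e + 1 = x + 1 + e := by ring
    rw [hs, smul_add, smul_smul, hpT, ← smul_smul, smul_comm p c, ← Int.cast_add]
    refine .step _ _ _ _ _ ih ?_ ?_
    · rwa [hx, hact, hact]
    · unfold IntertwinerCoeff
      rwa [hx, hact, hact]

variable (D ζ v) in
/-- The span of all reached vectors. -/
def reachedSpan : Submodule K V := Submodule.span K {y | ∃ k f, D.Reached ζ v k f y}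

omit [Fact (1 < n)] in
theorem reachedSpan_smul_mem {a : A}
    (ha : ∀ k f y, D.Reached ζ v k f y → a • y ∈ D.reachedSpan ζ v) {y : V}
    (hy : y ∈ D.reachedSpan ζ v) : a • y ∈ D.reachedSpan ζ v := by
  induction hy using Submodule.span_induction with
  | mem y hy => obtain ⟨k, f, h⟩ := hy; exact ha k f y h
  | zero => simp
  | add y z _ _ hy hz => rw [smul_add]; exact add_mem hy hz
  | smul c y _ hy => rw [smul_comm]; exact Submodule.smul_mem _ c hy

omit [IsScalarTower K A V] [Fact (1 < n)] in
theorem Reached.mem {k : ℕ} {f : ZMod n → ℤ} {y : V} (h : D.Reached ζ v k f y) :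
    y ∈ D.reachedSpan ζ v := Submodule.subset_span ⟨k, f, h⟩

omit [Fact (1 < n)] in
theorem P_smul_mem {y : V} (hy : y ∈ D.reachedSpan ζ v) : (D.P : A) • y ∈ D.reachedSpan ζ v := by
  refine reachedSpan_smul_mem (fun k f y h => (h.smul_of_shift (e := 1) ?_ ?_).mem) hy
  · simpa using D.P_T
  · intro m
    rw [add_comm, zpow_one_add, Units.val_mul]

omit [Fact (1 < n)] in
theorem P_inv_smul_mem {y : V} (hy : y ∈ D.reachedSpan ζ v) :
    ((D.P⁻¹ : Aˣ) : A) • y ∈ D.reachedSpan ζ v := by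
  refine reachedSpan_smul_mem (fun k f y h => (h.smul_of_shift (e := -1) ?_ ?_).mem) hy
  · intro i
    rw [Units.inv_mul_eq_iff_eq_mul, ← mul_assoc, D.P_T]
    simp [mul_assoc]
  · intro m
    rw [add_comm, zpow_add, Units.val_mul, zpow_neg_one]

theorem Y_smul_mem (hζ : ∀ x k : ℤ, ζ (x + k * n) = ((u ^ k : Kˣ) : K) * ζ x)
    (hv : ∀ x, D.Y x • v = ζ x • v) (x : ℤ) {y : V} (hy : y ∈ D.reachedSpan ζ v) :
    D.Y x • y ∈ D.reachedSpan ζ v :=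
  reachedSpan_smul_mem (fun k f y h => by
    rw [h.weight hζ hv]; exact Submodule.smul_mem _ _ h.mem) hy

theorem Y_inv_smul_mem (hζ0 : ∀ x, ζ x ≠ 0)
    (hζ : ∀ x k : ℤ, ζ (x + k * n) = ((u ^ k : Kˣ) : K) * ζ x)
    (hv : ∀ x, D.Y x • v = ζ x • v) {x : ℤ} {a : A} (ha : a * D.Y x = 1) {y : V}
    (hy : y ∈ D.reachedSpan ζ v) : a • y ∈ D.reachedSpan ζ v := by
  refine reachedSpan_smul_mem (fun k f y h => ?_) hy
  have hy : y = ζ (affineAct f x) • a • y := by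
    rw [smul_comm, ← h.weight hζ hv, smul_smul, ha, one_smul]
  have : a • y = (ζ (affineAct f x))⁻¹ • y := by
    conv_rhs => rw [hy]
    rw [inv_smul_smul₀ (hζ0 _)]
  rw [this]
  exact Submodule.smul_mem _ _ h.mem

theorem T_smul_mem (hτ : τ ≠ 0) (hζ0 : ∀ x, ζ x ≠ 0)
    (hζ : ∀ x k : ℤ, ζ (x + k * n) = ((u ^ k : Kˣ) : K) * ζ x)
    (hv : ∀ x, D.Y x • v = ζ x • v)
    (hsep : ∀ (x : ℤ) (c : K) (y : V), c ≠ 0 → D.Y x • y = c • y → D.Y (x + 1) • y = c • y → y = 0)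
    (i : ZMod n) {y : V} (hy : y ∈ D.reachedSpan ζ v) : D.T i • y ∈ D.reachedSpan ζ v := by
  refine reachedSpan_smul_mem (fun k f y h => ?_) hy
  obtain ⟨x, rfl⟩ := ZMod.intCast_surjective i
  by_cases he : ζ (affineAct f x) = ζ (affineAct f (x + 1))
  · rw [hsep x _ y (hζ0 _) (h.weight hζ hv x) (by rw [h.weight hζ hv, he]), smul_zero]
    exact zero_mem _
  rcases lt_trichotomy (affineAct f x) (affineAct f (x + 1)) with hlt | heq | hlt
  · have hs := (Reached.step k f y x _ h hlt
      (mul_div_cancel₀ (τ * ζ (affineAct f (x + 1))) (sub_ne_zero.2 he))).mem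
    exact (add_mem_cancel_right (Submodule.smul_mem _ _ h.mem)).1 hs
  · rw [heq] at he
    exact absurd rfl he
  · obtain ⟨k', y', c, rfl, h', -, rfl⟩ := h.exchange hτ hζ0 hζ x hlt
    have : D.T x • (D.T x • y' + c • y') =
        (τ + c) • (D.T x • y' + c • y') + (1 - (τ + c) * c) • y' := by
      rw [smul_add, T_smul_T_smul, smul_comm (D.T _)]
      generalize D.T (x : ZMod n) • y' = w
      module
    rw [this]
    exact add_mem (Submodule.smul_mem _ _ h.mem) (Submodule.smul_mem _ _ h'.mem)

/-- The weight space of the starting weight in the span of reached vectors is one-dimensional. -/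
theorem exists_eq_smul_of_weight (hτ : τ ≠ 0) (hζ0 : ∀ x, ζ x ≠ 0)
    (hζ : ∀ x k : ℤ, ζ (x + k * n) = ((u ^ k : Kˣ) : K) * ζ x)
    (hu : ∀ k : ℤ, u ^ k = 1 → k = 0)
    (hv : ∀ x, D.Y x • v = ζ x • v) {y : V} (hy : y ∈ D.reachedSpan ζ v)
    (hyw : ∀ x, D.Y x • y = ζ x • y) : ∃ c : K, y = c • v := by
  suffices H : ∃ c : K, ∃ d ∈ Algebra.adjoin K (Set.range D.Y), ∃ e : K, e ≠ 0 ∧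
      d • (y - c • v) = 0 ∧ ∀ w : V, (∀ x, D.Y x • w = ζ x • w) → d • w = e • w by
    obtain ⟨c, d, -, e, he, h₁, h₂⟩ := H
    refine ⟨c, sub_eq_zero.1 ?_⟩
    rw [h₂ _ fun x => by rw [smul_sub, hyw, smul_comm, hv, smul_sub, smul_comm c]] at h₁
    exact (smul_eq_zero.1 h₁).resolve_left he
  clear hyw
  induction hy using Submodule.span_induction with
  | mem y hy =>
    obtain ⟨k, f, h⟩ := hy
    by_cases hf : ∀ x, ζ (affineAct f x) = ζ x
    · refine ⟨1, 1, one_mem _, 1, one_ne_zero, ?_, by simp⟩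
      rw [h.eq_of_weight hτ hζ0 hζ hu hf]
      simp
    · push Not at hf
      obtain ⟨x, hx⟩ := hf
      refine ⟨0, D.Y x - algebraMap K A (ζ (affineAct f x)),
        sub_mem (Algebra.subset_adjoin ⟨x, rfl⟩) (Subalgebra.algebraMap_mem _ _),
        ζ x - ζ (affineAct f x), sub_ne_zero.2 hx.symm, ?_, ?_⟩
      · simp [sub_smul, h.weight hζ hv]
      · intro w hw
        simp [sub_smul, hw]
  | zero => exact ⟨0, 1, one_mem _, 1, one_ne_zero, by simp, by simp⟩
  | smul a y _ hy =>
    obtain ⟨c, d, hd, e, he, h₁, h₂⟩ := hy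
    refine ⟨a * c, d, hd, e, he, ?_, h₂⟩
    rw [mul_smul, ← smul_sub, smul_comm, h₁, smul_zero]
  | add y z _ _ hy hz =>
    obtain ⟨c, d, hd, e, he, h₁, h₂⟩ := hy
    obtain ⟨c', d', hd', e', he', h₁', h₂'⟩ := hz
    have hcomm : d * d' = d' * d := by
      refine Algebra.commute_of_mem_adjoin_of_forall_mem_commute hd' ?_
      rintro _ ⟨x, rfl⟩
      refine (Algebra.commute_of_mem_adjoin_of_forall_mem_commute hd ?_).symm
      rintro _ ⟨x', rfl⟩
      exact D.Y_comm _ _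
    refine ⟨c + c', d * d', mul_mem hd hd', e * e', mul_ne_zero he he', ?_, ?_⟩
    · rw [show y + z - (c + c') • v = (y - c • v) + (z - c' • v) by module, smul_add, hcomm,
        mul_smul, h₁, ← hcomm, mul_smul, h₁', smul_zero, smul_zero, add_zero]
    · intro w hw
      rw [mul_smul, h₂' w hw, smul_comm, h₂ w hw, smul_smul, mul_comm]

end Span

/-- In a module spanned by eigenvectors of `Y (x + 1)`, no nonzero vector has equal eigenvalues
for `Y x` and `Y (x + 1)`. -/
theorem eq_zero_of_equal_weights (hτ : τ ≠ 0) (x : ℤ)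
    (hspan : Submodule.span K {w : V | ∃ μ : K, D.Y (x + 1) • w = μ • w} = ⊤)
    {c : K} (hc : c ≠ 0) {y : V} (hy : D.Y x • y = c • y) (hy' : D.Y (x + 1) • y = c • y) :
    y = 0 := by
  set R := D.Y (x + 1) with hR
  have key : ∀ w : V, ∃ p : Polynomial K, p.eval c ≠ 0 ∧
      (Polynomial.aeval R p) • (R • w - c • w) = 0 := by
    intro w
    have hw : w ∈ Submodule.span K {w : V | ∃ μ : K, R • w = μ • w} := hspan ▸ Submodule.mem_top
    induction hw using Submodule.span_induction with
    | mem w hw =>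
      obtain ⟨μ, hμ⟩ := hw
      by_cases h : μ = c
      · exact ⟨1, by simp, by simp [hμ, h]⟩
      · refine ⟨Polynomial.X - Polynomial.C μ, by simpa [sub_eq_zero] using Ne.symm h, ?_⟩
        simp [sub_smul, smul_sub, hμ, smul_comm R, smul_comm c μ]
    | zero => exact ⟨1, by simp, by simp⟩
    | smul a w _ hw =>
      obtain ⟨p, hp, h⟩ := hw
      refine ⟨p, hp, ?_⟩
      rw [smul_comm R, smul_comm c, ← smul_sub, smul_comm, h, smul_zero]
    | add w z _ _ hw hz =>
      obtain ⟨p, hp, h⟩ := hw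
      obtain ⟨p', hp', h'⟩ := hz
      refine ⟨p * p', by simp [hp, hp'], ?_⟩
      rw [show R • (w + z) - c • (w + z) = (R • w - c • w) + (R • z - c • z) by
        rw [smul_add, smul_add]; abel, smul_add, mul_comm p p', map_mul, mul_smul, h, ← map_mul,
        mul_comm p' p, map_mul, mul_smul, h', smul_zero, smul_zero, add_zero]
  obtain ⟨p, hp, h⟩ := key (D.T x • y)
  have hT : R • D.T x • y - c • D.T x • y = (τ * c) • y := by
    rw [smul_smul, Y_succ_mul_T, add_smul, mul_smul, hy, smul_assoc, ← hR, hy', smul_comm (D.T _),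
      add_sub_cancel_left, mul_smul]
  have hpy : (Polynomial.aeval R p) • y = p.eval c • y := by
    clear h hp
    induction p using Polynomial.induction_on' with
    | add p q hp hq => rw [map_add, add_smul, hp, hq, Polynomial.eval_add, add_smul]
    | monomial k a =>
      have : R ^ k • y = c ^ k • y := by
        induction k with
        | zero => simp
        | succ k ih => rw [pow_succ, mul_smul, hy', smul_comm, ih, smul_smul, pow_succ']
      simp [Polynomial.aeval_monomial, mul_smul, this]
  rw [hT, smul_comm, hpy, smul_smul] at h
  exact (smul_eq_zero.1 h).resolve_left (mul_ne_zero (mul_ne_zero hτ hc) hp)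

end DoubleAffineData

namespace DAHA

variable {K : Type*} [Field K] {n : ℕ} [Fact (1 < n)] {q t : Kˣ}

theorem natCast_pos_int : (0 : ℤ) < n := by
  have := Fact.out (p := 1 < n)
  omega

theorem sub_ne_inv {t : Kˣ} (ht : t ^ 2 ≠ 1) : (t : K) - ((t⁻¹ : Kˣ) : K) ≠ 0 := by
  rw [sub_ne_zero, Ne, Units.val_inj, eq_inv_iff_mul_eq_one, ← sq]
  exact ht

/-- The residue of an integer modulo `n`, as an index of the generators `Y`. -/
def idx (n : ℕ) [Fact (1 < n)] (x : ℤ) : Fin n :=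
  ⟨(x % n).toNat, by
    have h := natCast_pos_int (n := n)
    have := Int.emod_lt_of_pos x h
    have := Int.emod_nonneg x h.ne'
    omega⟩

theorem idx_val (x : ℤ) : ((idx n x : ℕ) : ℤ) = x % n :=
  Int.toNat_of_nonneg (Int.emod_nonneg x natCast_pos_int.ne')

theorem idx_cast (x : ℤ) : ((idx n x : ℕ) : ZMod n) = x := by
  rw [← Int.cast_natCast, idx_val]
  simp

theorem idx_succ (x : ℤ) :
    ((idx n (x + 1) : ℕ) = (idx n x : ℕ) + 1 ∧ (x + 1) / n = x / n) ∨
      ((idx n x : ℕ) = n - 1 ∧ (idx n (x + 1) : ℕ) = 0 ∧ (x + 1) / n = x / n + 1) := by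
  have h := natCast_pos_int (n := n)
  have h₁ := Int.emod_lt_of_pos x h
  have h₂ := Int.emod_nonneg x h.ne'
  have h₃ := Int.emod_add_mul_ediv x n
  have e₁ := idx_val (n := n) x
  have e₂ := idx_val (n := n) (x + 1)
  by_cases hlt : x % n + 1 < n
  · obtain ⟨h₄, h₅⟩ := (Int.ediv_emod_unique h (a := x + 1) (r := x % n + 1) (q := x / n)).2
      ⟨by linarith, by omega, hlt⟩
    left
    omega
  · obtain ⟨h₄, h₅⟩ := (Int.ediv_emod_unique h (a := x + 1) (r := 0) (q := x / n + 1)).2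
      ⟨by rw [mul_add]; omega, le_rfl, h⟩
    right
    omega

/-- The elements of the double affine Hecke algebra with `Y` extended to all integers by
`Y (x + n) = q⁻¹ Y x`. -/
def data (K : Type*) [Field K] (n : ℕ) [Fact (1 < n)] (q t : Kˣ) :
    DoubleAffineData K (DAHA K n q t) n ((t : K) - ((t⁻¹ : Kˣ) : K)) where
  T i := Telt K n q t (i + 1)
  Y x := ((q⁻¹ ^ (x / n) : Kˣ) : K) • Yelt K n q t (idx n x)
  P := ⟨Pelt K n q t, Pinvelt K n q t,
    by simpa [Pelt, Pinvelt] using RingQuot.mkAlgHom_rel K (DahaRel.pPinv (K := K) (q := q) (t := t)),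
    by simpa [Pelt, Pinvelt] using RingQuot.mkAlgHom_rel K (DahaRel.pinvP (K := K) (q := q) (t := t))⟩
  T_mul_self i := by
    have h := RingQuot.mkAlgHom_rel K (DahaRel.hecke (q := q) (t := t) (i + 1))
    have ht : algebraMap K (DAHA K n q t) t * algebraMap K (DAHA K n q t) ((t⁻¹ : Kˣ) : K) = 1 := by
      rw [← map_mul]; simp
    simp only [sc, map_mul, map_sub, map_add, AlgHom.commutes, map_zero] at h
    change (Telt K n q t (i + 1) - _) * (Telt K n q t (i + 1) + _) = 0 at h
    rw [sub_mul, mul_add, mul_add, ht, ← Algebra.commutes] at h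
    rw [Algebra.smul_def, map_sub, sub_mul, ← sub_eq_zero, ← h]
    abel
  braid i := by
    simpa [Telt] using RingQuot.mkAlgHom_rel K (DahaRel.braid (q := q) (t := t) (i + 1))
  T_comm i j h₁ h₂ := by
    simpa [Telt] using RingQuot.mkAlgHom_rel K (DahaRel.tcomm (q := q) (t := t) (i + 1) (j + 1)
      (by simpa using h₁) (by simpa using h₂))
  Y_comm x y := by
    have h : Yelt K n q t (idx n x) * Yelt K n q t (idx n y) =
        Yelt K n q t (idx n y) * Yelt K n q t (idx n x) := by
      simpa [Yelt] using RingQuot.mkAlgHom_rel K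
        (DahaRel.ycomm (q := q) (t := t) (idx n x) (idx n y))
    rw [smul_mul_smul_comm, h, smul_mul_smul_comm, mul_comm]
  TYT x := by
    rw [mul_smul_comm, smul_mul_assoc]
    rcases idx_succ (n := n) x with ⟨h₁, h₂⟩ | ⟨h₁, h₂, h₃⟩
    · have := RingQuot.mkAlgHom_rel K (DahaRel.tyt (q := q) (t := t) _ _ h₁)
      simp only [map_mul, Nat.cast_add, Nat.cast_one, idx_cast] at this
      rw [h₂]
      congr 1
    · have := RingQuot.mkAlgHom_rel K (DahaRel.t0yt0 (q := q) (t := t) _ _ h₁ h₂)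
      have hx : (x : ZMod n) + 1 = 0 := by
        rw [← idx_cast, h₁, ← Nat.cast_add_one,
          Nat.sub_add_cancel (Fact.out (p := 1 < n)).le, ZMod.natCast_self]
      simp only [map_mul, sc, ← Algebra.smul_def, map_smul] at this
      rw [h₃, zpow_add_one, Units.val_mul, mul_smul, hx]
      congr 1
  TY_comm i x h₁ h₂ := by
    have := RingQuot.mkAlgHom_rel K (DahaRel.tycomm (q := q) (t := t) (i + 1) (idx n x)
      (by simpa [idx_cast] using h₁) (by simpa [idx_cast] using h₂))
    simp only [map_mul] at this
    rw [mul_smul_comm, smul_mul_assoc]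
    congr 1
  P_T i := by
    have := RingQuot.mkAlgHom_rel K (DahaRel.ptp (q := q) (t := t) (i + 1))
    simp only [map_mul] at this
    rwa [← Units.mul_inv_eq_iff_eq_mul]
  P_Y x := by
    rw [← Units.mul_inv_eq_iff_eq_mul, mul_smul_comm, smul_mul_assoc]
    rcases idx_succ (n := n) x with ⟨h₁, h₂⟩ | ⟨h₁, h₂, h₃⟩
    · have := RingQuot.mkAlgHom_rel K (DahaRel.pyp (q := q) (t := t) _ _ h₁)
      simp only [map_mul] at this
      rw [h₂]
      congr 1
    · have := RingQuot.mkAlgHom_rel K (DahaRel.pynp (q := q) (t := t) _ _ h₁ h₂)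
      simp only [map_mul, sc, ← Algebra.smul_def, map_smul] at this
      rw [h₃, zpow_add_one, Units.val_mul, mul_smul]
      congr 1

/-- The extension of a weight to all integers matching that of the generators `Y`. -/
def extWeight (q : Kˣ) (z : Fin n → Kˣ) (x : ℤ) : K := ((q⁻¹ ^ (x / n) * z (idx n x) : Kˣ) : K)

theorem extWeight_ne_zero (z : Fin n → Kˣ) (x : ℤ) : extWeight q z x ≠ 0 := Units.ne_zero _

theorem extWeight_add_mul (z : Fin n → Kˣ) (x k : ℤ) :
    extWeight q z (x + k * n) = ((q⁻¹ ^ k : Kˣ) : K) * extWeight q z x := by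
  have hi : idx n (x + k * n) = idx n x := by simp [idx]
  unfold extWeight
  rw [hi, Int.add_mul_ediv_right _ _ natCast_pos_int.ne', ← Units.val_mul, zpow_add]
  congr 1
  rw [← mul_assoc, mul_comm (q⁻¹ ^ k)]

variable {V : Type*} [AddCommGroup V] [Module K V] [Module (DAHA K n q t) V]
  [IsScalarTower K (DAHA K n q t) V]

theorem data_Y_smul {z : Fin n → Kˣ} {v : V} (hv : v ∈ wtSet K n q t V z) (x : ℤ) :
    (data K n q t).Y x • v = extWeight q z x • v := by
  have h := hv (idx n x)
  rw [algebraMap_smul] at h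
  change (((q⁻¹ ^ (x / n) : Kˣ) : K) • Yelt K n q t (idx n x)) • v = _
  rw [smul_assoc, h, smul_smul]
  simp [extWeight]

theorem eq_zero_of_equal_weights (ht : t ^ 2 ≠ 1)
    (hV : Submodule.span K (⋃ w : Fin n → Kˣ, wtSet K n q t V w) = ⊤) (x : ℤ) (c : K) (y : V)
    (hc : c ≠ 0) (hy : (data K n q t).Y x • y = c • y)
    (hy' : (data K n q t).Y (x + 1) • y = c • y) : y = 0 := by
  refine (data K n q t).eq_zero_of_equal_weights (sub_ne_inv ht) x ?_ hc hy hy'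
  rw [eq_top_iff, ← hV]
  refine Submodule.span_mono (Set.iUnion_subset fun z w hw => ⟨_, data_Y_smul hw (x + 1)⟩)

theorem smul_mem_reachedSpan (ht : t ^ 2 ≠ 1) {z : Fin n → Kˣ} {v : V}
    (hv : v ∈ wtSet K n q t V z)
    (hsep : ∀ (x : ℤ) (c : K) (y : V), c ≠ 0 → (data K n q t).Y x • y = c • y →
      (data K n q t).Y (x + 1) • y = c • y → y = 0) (a : DAHA K n q t) {y : V}
    (hy : y ∈ (data K n q t).reachedSpan (extWeight q z) v) :
    a • y ∈ (data K n q t).reachedSpan (extWeight q z) v := by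
  have hY : ∀ i : Fin n, (data K n q t).Y (i : ℕ) = Yelt K n q t i := by
    intro i
    have h₁ : idx n (i : ℕ) = i := by
      apply Fin.ext
      zify
      rw [idx_val]
      exact Int.emod_eq_of_lt (by omega) (by omega)
    have h₂ : ((i : ℕ) : ℤ) / n = 0 := Int.ediv_eq_zero_of_lt (by omega) (by omega)
    simp [data, h₁, h₂]
  obtain ⟨b, rfl⟩ := RingQuot.mkAlgHom_surjective K (DahaRel K n q t) a
  induction b using FreeAlgebra.induction generalizing y with
  | grade0 r =>
    rw [AlgHom.commutes, algebraMap_smul]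
    exact Submodule.smul_mem _ r hy
  | grade1 g =>
    cases g with
    | T i =>
      have := DoubleAffineData.T_smul_mem (D := data K n q t) (sub_ne_inv ht) (extWeight_ne_zero z)
        (extWeight_add_mul z) (data_Y_smul hv) hsep (i - 1) hy
      rwa [show (data K n q t).T (i - 1) = Telt K n q t i from
        congrArg (Telt K n q t) (sub_add_cancel i 1)] at this
    | P => exact DoubleAffineData.P_smul_mem (D := data K n q t) hy
    | Pinv => exact DoubleAffineData.P_inv_smul_mem (D := data K n q t) hy
    | Y i =>
      have := DoubleAffineData.Y_smul_mem (D := data K n q t) (extWeight_add_mul z)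
        (data_Y_smul hv) (i : ℕ) hy
      rwa [hY] at this
    | Yinv i =>
      refine DoubleAffineData.Y_inv_smul_mem (D := data K n q t) (extWeight_ne_zero z)
        (extWeight_add_mul z) (data_Y_smul hv) (x := (i : ℕ)) ?_ hy
      rw [hY]
      have h := RingQuot.mkAlgHom_rel K (DahaRel.yinvY (q := q) (t := t) i)
      rwa [map_mul, map_one] at h
  | mul a b ha hb =>
    rw [map_mul, mul_smul]
    exact ha (hb hy)
  | add a b ha hb =>
    rw [map_add, add_smul]
    exact add_mem (ha hy) (hb hy)

/-- In a cyclic module generated by a weight vector, the weight space of the generator is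
one-dimensional. -/
theorem exists_eq_smul_of_mem_wtSet (hq : ∀ m : ℕ, 1 ≤ m → q ^ m ≠ 1) (ht : t ^ 2 ≠ 1)
    {z : Fin n → Kˣ} {v : V} (hv : v ∈ wtSet K n q t V z)
    (hsep : ∀ (x : ℤ) (c : K) (y : V), c ≠ 0 → (data K n q t).Y x • y = c • y →
      (data K n q t).Y (x + 1) • y = c • y → y = 0) (a : DAHA K n q t)
    (ha : a • v ∈ wtSet K n q t V z) : ∃ c : K, a • v = c • v := by
  have hvS : v ∈ (data K n q t).reachedSpan (extWeight q z) v := by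
    have := (DoubleAffineData.Reached.base (D := data K n q t) (ζ := extWeight q z) (v := v) 0).mem
    simpa using this
  refine DoubleAffineData.exists_eq_smul_of_weight (D := data K n q t) (sub_ne_inv ht)
    (extWeight_ne_zero z) (extWeight_add_mul z) (fun k hk => ?_) (data_Y_smul hv)
    (smul_mem_reachedSpan ht hv hsep a hvS) (data_Y_smul ha)
  by_contra hk0
  refine hq k.natAbs (by omega) ?_
  rcases Int.natAbs_eq k with h | h <;> rw [h] at hk <;> simpa using hk

variable {W : Type*} [AddCommGroup W] [Module K W] [Module (DAHA K n q t) W]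
  [IsScalarTower K (DAHA K n q t) W]

/-- If two modules share a weight and the second is simple, an element annihilating a weight vector
of the first annihilates every vector of the same weight in the second. -/
theorem smul_eq_zero_of_mem_wtSet (hq : ∀ m : ℕ, 1 ≤ m → q ^ m ≠ 1) (ht : t ^ 2 ≠ 1)
    (hV : Submodule.span K (⋃ w : Fin n → Kˣ, wtSet K n q t V w) = ⊤)
    (hW : Submodule.span K (⋃ w : Fin n → Kˣ, wtSet K n q t W w) = ⊤)
    [IsSimpleModule (DAHA K n q t) W] {z : Fin n → Kˣ} {v : V} {w : W}
    (hv : v ∈ wtSet K n q t V z) (hv0 : v ≠ 0) (hw : w ∈ wtSet K n q t W z)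
    {a : DAHA K n q t} (ha : a • v = 0) : a • w = 0 := by
  by_contra h
  obtain ⟨b, hb⟩ := IsSimpleModule.toSpanSingleton_surjective (DAHA K n q t) h w
  rw [LinearMap.toSpanSingleton_apply, smul_smul] at hb
  have hba : (b * a) • (v, w) = (0, w) := by
    rw [Prod.smul_mk, hb, mul_smul, ha, smul_zero]
  have hvw : (v, w) ∈ wtSet K n q t (V × W) z := fun i => Prod.ext (hv i) (hw i)
  have h0w : (0, w) ∈ wtSet K n q t (V × W) z := fun i => Prod.ext (by simp) (hw i)
  obtain ⟨c, hc⟩ := exists_eq_smul_of_mem_wtSet hq ht hvw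
    (fun x c y hc hy hy' => Prod.ext
      (eq_zero_of_equal_weights ht hV x c y.1 hc (congrArg Prod.fst hy) (congrArg Prod.fst hy'))
      (eq_zero_of_equal_weights ht hW x c y.2 hc (congrArg Prod.snd hy) (congrArg Prod.snd hy')))
    (b * a) (by rwa [hba])
  rw [hba, Prod.smul_mk, Prod.mk.injEq] at hc
  have hc0 : c = 0 := (smul_eq_zero.1 hc.1.symm).resolve_right hv0
  have hw0 : w = 0 := by simpa [hc0] using hc.2
  exact h (by rw [hw0, smul_zero])

omit [Fact (1 < n)] [Module K V] [IsScalarTower K (DAHA K n q t) V] in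
theorem exists_ne_zero_of_wtSet_ne {z : Fin n → Kˣ} (h : wtSet K n q t V z ≠ {0}) :
    ∃ v ∈ wtSet K n q t V z, v ≠ 0 := by
  by_contra! h'
  exact h (Set.Subset.antisymm h' (by simp [wtSet]))

end DAHA

/-- Two simple `Y`-semisimple `H_{q,t}(GL_n)`-modules are either isomorphic or
have disjoint supports. -/
theorem stmt14 (K : Type*) [Field K] (n : ℕ) (hn : 2 ≤ n) (q t : Kˣ)
    (hq : ∀ m : ℕ, 1 ≤ m → q ^ m ≠ 1) (ht : ∀ m : ℕ, 1 ≤ m → t ^ m ≠ 1)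
    (M : Type*) [AddCommGroup M] [Module K M] [Module (DAHA K n q t) M]
    [IsScalarTower K (DAHA K n q t) M]
    (N' : Type*) [AddCommGroup N'] [Module K N'] [Module (DAHA K n q t) N']
    [IsScalarTower K (DAHA K n q t) N']
    (hsM : IsSimpleModule (DAHA K n q t) M)
    (hssM : Submodule.span K (⋃ w : Fin n → Kˣ, wtSet K n q t M w) = ⊤)
    (hsN : IsSimpleModule (DAHA K n q t) N')
    (hssN : Submodule.span K (⋃ w : Fin n → Kˣ, wtSet K n q t N' w) = ⊤) :
    Nonempty (M ≃ₗ[DAHA K n q t] N') ∨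
      ∀ z : Fin n → Kˣ, wtSet K n q t M z = {0} ∨ wtSet K n q t N' z = {0} := by
  have : Fact (1 < n) := ⟨hn⟩
  have ht' : t ^ 2 ≠ 1 := ht 2 one_le_two
  by_contra hcon
  push Not at hcon
  obtain ⟨hiso, z, hM, hN⟩ := hcon
  obtain ⟨v, hv, hv0⟩ := DAHA.exists_ne_zero_of_wtSet_ne hM
  obtain ⟨w, hw, hw0⟩ := DAHA.exists_ne_zero_of_wtSet_ne hN
  let φ := LinearMap.toSpanSingleton (DAHA K n q t) M v
  let ψ := LinearMap.toSpanSingleton (DAHA K n q t) N' w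
  have hker : LinearMap.ker φ = LinearMap.ker ψ := by
    ext a
    simp only [LinearMap.mem_ker, φ, ψ, LinearMap.toSpanSingleton_apply]
    exact ⟨DAHA.smul_eq_zero_of_mem_wtSet hq ht' hssM hssN hv hv0 hw,
      DAHA.smul_eq_zero_of_mem_wtSet hq ht' hssN hssM hw hw0 hv⟩
  refine hiso.false ?_
  exact (φ.quotKerEquivOfSurjective (IsSimpleModule.toSpanSingleton_surjective _ hv0)).symm ≪≫ₗ
    Submodule.quotEquivOfEq _ _ hker ≪≫ₗ
    ψ.quotKerEquivOfSurjective (IsSimpleModule.toSpanSingleton_surjective _ hw0)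
end
end

section
/- Let N, k, n be integers with N, k ≥ 1 and n ≥ 1. Let a, b : {1, …, n} → ℤ satisfy a(1) = 0, a(n) = k − N, and 1 − N ≤ b(j) ≤ k − 1 for all j. Let γ : {1, …, n} → ℤ be weakly increasing (γ(1) ≤ γ(2) ≤ ⋯ ≤ γ(n)). If there exists a permutation ρ of {1, …, n} such that a(i) − k·γ(i) = b(ρ(i)) for all i, then γ(i) = 0 for all i. -/
theorem stmt16 (N k n : ℕ) (hN : 1 ≤ N) (hk : 1 ≤ k) (hn : 1 ≤ n)
    (a b : Fin n → ℤ)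
    (ha1 : a ⟨0, hn⟩ = 0)
    (han : a ⟨n - 1, by omega⟩ = (k : ℤ) - (N : ℤ))
    (hb : ∀ j : Fin n, 1 - (N : ℤ) ≤ b j ∧ b j ≤ (k : ℤ) - 1)
    (γ : Fin n → ℤ) (hγ : Monotone γ)
    (ρ : Equiv.Perm (Fin n))
    (h : ∀ i : Fin n, a i - (k : ℤ) * γ i = b (ρ i)) :
    ∀ i : Fin n, γ i = 0 := by
  intro i
  have hkpos : (0 : ℤ) < k := by exact_mod_cast hk
  have hfirst : 0 ≤ γ ⟨0, hn⟩ := by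
    have h₀ := h ⟨0, hn⟩
    have hle := (hb (ρ ⟨0, hn⟩)).2
    by_contra! hneg
    nlinarith
  have hlast : γ ⟨n - 1, by omega⟩ ≤ 0 := by
    have h₁ := h ⟨n - 1, by omega⟩
    have hge := (hb (ρ ⟨n - 1, by omega⟩)).1
    by_contra! hpos
    nlinarith
  have hge : γ ⟨0, hn⟩ ≤ γ i := hγ (Fin.mk_le_of_le_val (Nat.zero_le _))
  have hle : γ i ≤ γ ⟨n - 1, by omega⟩ := hγ (Fin.le_def.mpr (Nat.le_sub_one_of_lt i.isLt))
  exact le_antisymm (hle.trans hlast) (hfirst.trans hge)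
end
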